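/- arXiv:2506.21652 — 2 statements merged into one kernel-verified Lean document; each statement's English description precedes it below -/
import Mathlib

section
/- Let η be an L-subgroup of μ. Then η is a normal L-subgroup of μ (i.e., η(yxy⁻¹) ≥ η(x) ∧ μ(y) for all x, y) if and only if η^{a_z} ⊆ η for every L-point a_z of μ. -/
open scoped Classical

section Defs

variable {G : Type*} [Group G] {L : Type*} [CompletelyDistribLattice L]

/-- `μ` is an `L`-subgroup of the group `G`. -/
def IsLSubgroup (μ : G → L) : Prop :=
  (∀ x y : G, μ x ⊓ μ y ≤ μ (x * y)) ∧ (∀ x : G, μ x⁻¹ = μ x)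

/-- The conjugate `η^{a_z}` of `η` by the `L`-point `a_z`. -/
def LConj (η : G → L) (a : L) (z : G) : G → L :=
  fun x => a ⊓ η (z * x * z⁻¹)

/-- The `L`-subgroup generated by the `L`-subset `η`. -/
def LGen (η : G → L) : G → L :=
  fun x => ⨅ θ ∈ {θ : G → L | IsLSubgroup θ ∧ η ≤ θ}, θ x

/-- `η` is a pronormal `L`-subgroup of `μ`. -/
def IsLPronormal (μ η : G → L) : Prop :=
  IsLSubgroup η ∧ η ≤ μ ∧
    ∀ (a : L) (x : G), a ≤ μ x →
      ∃ (b : L) (y : G), b ≤ LGen (η ⊔ LConj η a x) y ∧ LConj η b y = LConj η a x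

/-- `η` is a normal `L`-subgroup of `μ`. -/
def IsLNormal (μ η : G → L) : Prop :=
  IsLSubgroup η ∧ η ≤ μ ∧ ∀ x y : G, η x ⊓ μ y ≤ η (y * x * y⁻¹)

/-- Set product of two `L`-subsets. -/
def LSetProd (η ν : G → L) : G → L :=
  fun x => ⨆ y : G, ⨆ z : G, ⨆ _ : y * z = x, η y ⊓ ν z

/-- The normalizer `N(η)` of `η` in `μ`. -/
def LNormalizer (μ η : G → L) : G → L :=
  fun z => sSup {a : L | a ≤ μ z ∧ LConj η a z ≤ η}

/-- The conjugate `μημ⁻¹` of `η` in `μ`. -/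
def LConjAll (μ η : G → L) : G → L :=
  fun x => ⨆ z : G, ⨆ y : G, ⨆ _ : x = z * y * z⁻¹, η y ⊓ μ z

/-- The normal closure `η^μ` of `η` in `μ`. -/
def LNormalClosure (μ η : G → L) : G → L := LGen (LConjAll μ η)

/-- The normal closure series `η₀ = μ`, `ηᵢ₊₁ = η^{ηᵢ}`. -/
def LNcSeries (μ η : G → L) : ℕ → (G → L)
  | 0 => μ
  | n + 1 => LNormalClosure (LNcSeries μ η n) η

/-- `η` is a subnormal `L`-subgroup of `μ`. -/
def IsLSubnormal (μ η : G → L) : Prop := ∃ m : ℕ, LNcSeries μ η m = η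

/-- The commutator `(η, θ)` of two `L`-subsets. -/
noncomputable def LCommFun (η θ : G → L) : G → L :=
  fun x =>
    if ∃ y z : G, x = y * z * y⁻¹ * z⁻¹ then
      ⨆ y : G, ⨆ z : G, ⨆ _ : x = y * z * y⁻¹ * z⁻¹, η y ⊓ θ z
    else (⨅ g : G, η g) ⊓ (⨅ g : G, θ g)

/-- The descending central chain `Z₀(μ) = μ`, `Zᵢ₊₁(μ) = [Zᵢ(μ), μ]`. -/
noncomputable def LDcc (μ : G → L) : ℕ → (G → L)
  | 0 => μ
  | n + 1 => LGen (LCommFun (LDcc μ n) μ)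

/-- The trivial `L`-subgroup with the same tip and tail as `μ`. -/
noncomputable def LTrivial (μ : G → L) : G → L :=
  fun x => if x = 1 then μ 1 else ⨅ g : G, μ g

/-- `μ` is a nilpotent `L`-group. -/
def IsLNilpotent (μ : G → L) : Prop := ∃ n : ℕ, LDcc μ n = LTrivial μ

/-- Sup-property of an `L`-subset. -/
def SupProp (μ : G → L) : Prop :=
  ∀ A : Set G, A.Nonempty → ∃ a ∈ A, μ a = ⨆ x ∈ A, μ x

end Defs

/-- Image of an `L`-subset under a map. -/
def LImage {G H L : Type*} [CompleteLattice L] (f : G → H) (μ : G → L) : H → L :=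
  fun y => ⨆ x : G, ⨆ _ : f x = y, μ x

theorem stmt7 {G : Type*} [Group G] {L : Type*} [CompletelyDistribLattice L]
    (μ η : G → L) (hμ : IsLSubgroup μ) (hη : IsLSubgroup η) (hle : η ≤ μ) :
    (∀ x y : G, η x ⊓ μ y ≤ η (y * x * y⁻¹)) ↔
      ∀ (a : L) (z : G), a ≤ μ z → LConj η a z ≤ η := by
  constructor
  · intro h a z ha x
    have h1 := h (z * x * z⁻¹) z⁻¹
    have e : z⁻¹ * (z * x * z⁻¹) * z⁻¹⁻¹ = x := by group
    rw [e, hμ.2] at h1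
    exact le_trans (le_inf inf_le_right (inf_le_left.trans ha)) h1
  · intro h x y
    have h1 := h (μ y) y⁻¹ (hμ.2 y).ge (y * x * y⁻¹)
    have e : y⁻¹ * (y * x * y⁻¹) * y⁻¹⁻¹ = x := by group
    simp only [LConj] at h1
    rw [e, inf_comm] at h1
    exact h1
end

section
/- Let η be a normal L-subgroup of μ and ν a pronormal L-subgroup of μ with tip(η) = tip(ν). Then the set product η ∘ ν is a pronormal L-subgroup of μ. -/
open scoped Classical

section Helpers

variable {G : Type*} [Group G] {L : Type*} [CompletelyDistribLattice L]

theorem lgen_le {θ ρ : G → L} (hρ : IsLSubgroup ρ) (h : θ ≤ ρ) : LGen θ ≤ ρ := by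
  intro x
  exact iInf₂_le (f := fun (θ' : G → L) (_ : θ' ∈ {θ' : G → L | IsLSubgroup θ' ∧ θ ≤ θ'}) => θ' x)
    ρ ⟨hρ, h⟩

theorem lgen_mono {θ ρ : G → L} (h : θ ≤ ρ) : LGen θ ≤ LGen ρ := by
  intro x
  refine le_iInf₂ fun σ hσ => ?_
  exact lgen_le hσ.1 (h.trans hσ.2) x

theorem le_one_of {ν : G → L} (h : IsLSubgroup ν) (g : G) : ν g ≤ ν 1 := by
  have := h.1 g g⁻¹
  rwa [h.2, inf_idem, mul_inv_cancel] at this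

theorem le_prod (η ν : G → L) (y z x : G) (h : y * z = x) : η y ⊓ ν z ≤ LSetProd η ν x :=
  le_iSup_of_le y (le_iSup_of_le z (le_iSup_of_le h le_rfl))

theorem prod_subgroup {μ η ν : G → L} (hnor : IsLNormal μ η)
    (hν : IsLSubgroup ν) (hνμ : ν ≤ μ) : IsLSubgroup (LSetProd η ν) := by
  obtain ⟨hη, hημ, hn⟩ := hnor
  have hinv : ∀ x, LSetProd η ν x ≤ LSetProd η ν x⁻¹ := by
    intro x
    refine iSup_le fun u => iSup_le fun v => iSup_le fun h => ?_
    refine le_trans ?_ (le_prod η ν (v⁻¹ * u⁻¹ * v⁻¹⁻¹) v⁻¹ _ (by rw [← h]; group))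
    refine le_inf (le_trans ?_ (hn _ _)) (by rw [hν.2]; exact inf_le_right)
    rw [hη.2]
    refine le_inf inf_le_left (inf_le_right.trans ?_)
    have := hνμ v⁻¹
    rwa [hν.2] at this
  refine ⟨fun x y => ?_, fun x => le_antisymm ?_ (hinv x)⟩
  · unfold LSetProd
    simp only [iSup_inf_eq, inf_iSup_eq]
    refine iSup_le fun u => iSup_le fun v => iSup_le fun h => ?_
    refine iSup_le fun u' => iSup_le fun v' => iSup_le fun h' => ?_
    refine le_trans ?_ (le_prod η ν (u' * (v' * u * v'⁻¹)) (v' * v) _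
      (by rw [← h, ← h']; group))
    have h1 : η u' ⊓ ν v' ⊓ (η u ⊓ ν v) ≤ η u' := inf_le_left.trans inf_le_left
    have h2 : η u' ⊓ ν v' ⊓ (η u ⊓ ν v) ≤ ν v' := inf_le_left.trans inf_le_right
    have h3 : η u' ⊓ ν v' ⊓ (η u ⊓ ν v) ≤ η u := inf_le_right.trans inf_le_left
    have h4 : η u' ⊓ ν v' ⊓ (η u ⊓ ν v) ≤ ν v := inf_le_right.trans inf_le_right
    exact le_inf (le_trans (le_inf h1 (le_trans (le_inf h3 (h2.trans (hνμ v'))) (hn _ _)))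
      (hη.1 _ _)) (le_trans (le_inf h2 h4) (hν.1 _ _))
  · have := hinv x⁻¹
    rwa [inv_inv] at this

theorem conj_le {μ η ν : G → L} (hμ : IsLSubgroup μ) (hnor : IsLNormal μ η) {a b : L} {x y : G}
    (ha : a ≤ μ x) (hb : b ≤ μ y) (h : LConj ν b y ≤ LConj ν a x) :
    LConj (LSetProd η ν) b y ≤ LConj (LSetProd η ν) a x := by
  obtain ⟨hη, hημ, hn⟩ := hnor
  intro g
  unfold LConj
  conv_lhs => unfold LSetProd
  simp only [inf_iSup_eq]
  refine iSup_le fun u => iSup_le fun v => iSup_le fun e => ?_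
  have h0 := h (y⁻¹ * v * y)
  simp only [LConj] at h0
  rw [show y * (y⁻¹ * v * y) * y⁻¹ = v by group] at h0
  have h1 : b ⊓ (η u ⊓ ν v) ≤ b := inf_le_left
  have h2 : b ⊓ (η u ⊓ ν v) ≤ η u := inf_le_right.trans inf_le_left
  have h3 : b ⊓ (η u ⊓ ν v) ≤ ν v := inf_le_right.trans inf_le_right
  have h4 := (le_inf h1 h3).trans h0
  have h5 := h4.trans inf_le_left
  refine le_inf h5 ?_
  refine le_trans ?_ (le_prod η ν (x * (y⁻¹ * u * y⁻¹⁻¹) * x⁻¹) (x * (y⁻¹ * v * y) * x⁻¹) _ ?_)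
  · refine le_inf (le_trans (le_inf (le_trans (le_inf h2 ?_) (hn _ _)) (h5.trans ha)) (hn _ _))
      (h4.trans inf_le_right)
    rw [hμ.2]
    exact h1.trans hb
  · have : g = y⁻¹ * (u * v) * y := by rw [e]; group
    rw [this]; group

end Helpers

theorem stmt12 {G : Type*} [Group G] {L : Type*} [CompletelyDistribLattice L]
    (μ η ν : G → L) (hμ : IsLSubgroup μ)
    (hnor : IsLNormal μ η) (hpro : IsLPronormal μ ν) (htip : η 1 = ν 1) :
    IsLPronormal μ (LSetProd η ν) := by
  obtain ⟨hν, hνμ, hp⟩ := hpro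
  have hνP : ν ≤ LSetProd η ν := by
    intro g
    refine le_trans (le_inf ?_ le_rfl) (le_prod η ν 1 g g (one_mul g))
    rw [htip]
    exact le_one_of hν g
  refine ⟨prod_subgroup hnor hν hνμ, ?_, ?_⟩
  · intro g
    refine iSup_le fun u => iSup_le fun v => iSup_le fun h => ?_
    rw [← h]
    exact (inf_le_inf (hnor.2.1 u) (hνμ v)).trans (hμ.1 u v)
  · intro a x ha
    obtain ⟨b, y, hb, he⟩ := hp a x ha
    have hbμ : b ≤ μ y := by
      refine hb.trans (lgen_le hμ (sup_le hνμ ?_) y)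
      intro g
      have h1 : LConj ν a x g ≤ μ x := inf_le_left.trans ha
      have h2 : LConj ν a x g ≤ μ (x * g * x⁻¹) := inf_le_right.trans (hνμ _)
      have h3 := (le_inf (le_inf (h1.trans (hμ.2 x).ge) h2) h1).trans
        ((inf_le_inf_right _ (hμ.1 _ _)).trans (hμ.1 _ _))
      rwa [show x⁻¹ * (x * g * x⁻¹) * x = g by group] at h3
    refine ⟨b, y, hb.trans (lgen_mono (sup_le_sup hνP ?_) y), le_antisymm ?_ ?_⟩
    · intro g
      exact inf_le_inf_left _ (hνP _)
    · exact conj_le hμ hnor ha hbμ he.le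
    · exact conj_le hμ hnor hbμ ha he.ge
end
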